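/- arXiv:1008.3408 — 2 statements merged into one kernel-verified Lean document; each statement's English description precedes it below -/
import Mathlib

section
/- Let F be a finite field with q elements and k, m, n positive integers with 1 ≤ k ≤ n < m. Then q^{kn} < (minimum size of a k-dense subset of F^{m×n}) < q^{km}; that is: (a) every k-dense subset 𝒜 ⊆ F^{m×n} satisfies |𝒜| > q^{kn}, and (b) there exists a k-dense subset 𝒜 ⊆ F^{m×n} with |𝒜| < q^{km}. -/
open Matrix

/-- A set `𝒜 ⊆ F^{m×n}` is `k`-dense if `M𝒜 = F^{k×n}` for every full-rank
`M ∈ F^{k×m}`. -/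
def IsKDense {F : Type*} [Field F] [Fintype F] {m n : ℕ} (k : ℕ)
    (𝒜 : Set (Matrix (Fin m) (Fin n) F)) : Prop :=
  ∀ M : Matrix (Fin k) (Fin m) F, M.rank = k →
    (fun A => M * A) '' 𝒜 = (Set.univ : Set (Matrix (Fin k) (Fin n) F))

/-- A `q`-polynomial with `k` coefficients vanishing on a `k`-dimensional subspace is zero. -/
lemma gab_zero {F K : Type*} [Field F] [Fintype F] [Field K] [Finite K] [Algebra F K]
    (k : ℕ) (a : Fin k → K) (W : Submodule F K) (hW : k ≤ Module.finrank F W)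
    (h : ∀ x ∈ W, ∑ i, a i * x ^ (Fintype.card F ^ (i : ℕ)) = 0) : a = 0 := by
  classical
  have := Fintype.ofFinite K
  have hq1 : 1 < Fintype.card F := Fintype.one_lt_card
  set q := Fintype.card F with hq
  let P : Polynomial K := ∑ i, Polynomial.C (a i) * Polynomial.X ^ (q ^ (i : ℕ))
  have hdeg : P.degree < (q ^ k : ℕ) := by
    refine (Polynomial.degree_sum_le _ _).trans_lt ?_
    rw [Finset.sup_lt_iff (by exact_mod_cast WithBot.bot_lt_coe _)]
    intro i _
    refine (Polynomial.degree_C_mul_X_pow_le _ _).trans_lt ?_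
    exact_mod_cast Nat.pow_lt_pow_right hq1 i.2
  have hcard : q ^ k ≤ (Finset.univ.filter (fun x : K => x ∈ W)).card := by
    have h1 : Nat.card W = q ^ Module.finrank F W := by
      rw [Module.natCard_eq_pow_finrank (K := F), Nat.card_eq_fintype_card]
    have h2 : Nat.card W = (Finset.univ.filter (fun x : K => x ∈ W)).card := by
      rw [Nat.card_eq_fintype_card]
      exact Fintype.card_subtype _
    rw [← h2, h1]
    exact Nat.pow_le_pow_right (by omega) hW
  have hP : P = 0 := by
    refine Polynomial.eq_zero_of_degree_lt_of_eval_finset_eq_zero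
      (Finset.univ.filter (fun x : K => x ∈ W)) (hdeg.trans_le (by exact_mod_cast hcard)) ?_
    intro x hx
    have := h x (by simpa using hx)
    simpa [P, Polynomial.eval_finsetSum] using this
  ext i
  have hc : P.coeff (q ^ (i : ℕ)) = a i := by
    simp only [P, Polynomial.finsetSum_coeff, Polynomial.coeff_C_mul, Polynomial.coeff_X_pow]
    rw [Finset.sum_eq_single i]
    · simp
    · intro j _ hj
      have : q ^ (i : ℕ) ≠ q ^ (j : ℕ) := fun e =>
        hj (Fin.ext (Nat.pow_right_injective hq1 e).symm)
      simp [this]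
    · simp
  rw [← hc, hP]; simp

/-- The bilinear map `(a, x) ↦ ∑ aᵢ x^{q^i}`. -/
noncomputable def gabMap (F K : Type*) [Field F] [Fintype F] [Field K] [Algebra F K] (k : ℕ) :
    (Fin k → K) →ₗ[F] K →ₗ[F] K :=
  LinearMap.mk₂ F (fun a x => ∑ i, a i * (FiniteField.frobeniusAlgHom F K ^ (i : ℕ)) x)
    (by intro a b x; simp only [Pi.add_apply, add_mul, Finset.sum_add_distrib])
    (by intro c a x; simp only [Pi.smul_apply, smul_mul_assoc, Finset.smul_sum])
    (by intro a x y; simp only [map_add, mul_add, Finset.sum_add_distrib])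
    (by intro c a x; simp only [map_smul, mul_smul_comm, Finset.smul_sum])

lemma gabMap_apply {F K : Type*} [Field F] [Fintype F] [Field K] [Algebra F K] (k : ℕ)
    (a : Fin k → K) (x : K) :
    gabMap F K k a x = ∑ i, a i * x ^ (Fintype.card F ^ (i : ℕ)) := by
  simp only [gabMap, LinearMap.mk₂_apply, AlgHom.coe_pow, FiniteField.coe_frobeniusAlgHom,
    pow_iterate]

lemma upper_part {F : Type*} [Field F] [Fintype F] (k m n : ℕ)
    (hk : 1 ≤ k) (hkn : k ≤ n) (hnm : n < m) :
    ∃ 𝒜 : Set (Matrix (Fin m) (Fin n) F), IsKDense k 𝒜 ∧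
      𝒜.ncard < Fintype.card F ^ (k * m) := by
  classical
  obtain ⟨p, hp⟩ := CharP.exists F
  have : Fact p.Prime := ⟨CharP.char_is_prime F p⟩
  have : NeZero m := ⟨by omega⟩
  let K := FiniteField.Extension F p m
  have hfin : Module.finrank F K = m := FiniteField.finrank_extension F p m
  let b : Module.Basis (Fin m) F K := Module.finBasisOfFinrankEq F K hfin
  let A : (Fin k → K) → Matrix (Fin m) (Fin n) F := fun a =>
    Matrix.of fun i j => b.equivFun (gabMap F K k a (b (Fin.castLE hnm.le j))) i
  have hA0 : A 0 = 0 := by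
    ext i j
    simp [A]
  have hAinj : ∀ a, A a = 0 → a = 0 := by
    intro a ha
    let v : Fin n → K := fun j => b (Fin.castLE hnm.le j)
    have hv : LinearIndependent F v :=
      b.linearIndependent.comp _ (Fin.castLE_injective hnm.le)
    refine gab_zero k a (Submodule.span F (Set.range v)) ?_ ?_
    · rw [finrank_span_eq_card hv]; simpa using hkn
    · intro x hx
      rw [← gabMap_apply]
      have : Submodule.span F (Set.range v) ≤ LinearMap.ker (gabMap F K k a) := by
        rw [Submodule.span_le]
        rintro _ ⟨j, rfl⟩
        show gabMap F K k a (v j) = 0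
        apply b.equivFun.injective
        ext i
        have := congrFun (congrFun ha i) j
        simpa [A, v] using this
      exact this hx
  refine ⟨Set.range A \ {0}, ?_, ?_⟩
  · intro M hM
    let L : K →ₗ[F] (Fin k → F) := M.mulVecLin ∘ₗ b.equivFun.toLinearMap
    have hLr : Module.finrank F (LinearMap.range L) = k := by
      have : LinearMap.range L = LinearMap.range M.mulVecLin := by
        simp only [L]
        rw [LinearMap.range_comp_of_range_eq_top]
        exact LinearEquiv.range _
      rw [this]; exact hM
    have hLk := LinearMap.finrank_range_add_finrank_ker L
    let G : (Fin k → K) →ₗ[F] (Fin m → (Fin k → F)) :=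
      LinearMap.pi fun j => L ∘ₗ (gabMap F K k).flip (b j)
    have hG : ∀ a j, G a j = L (gabMap F K k a (b j)) := fun a j => rfl
    have hGinj : Function.Injective G := by
      rw [injective_iff_map_eq_zero]
      intro a ha
      have hz : L ∘ₗ gabMap F K k a = 0 := by
        apply b.ext
        intro j
        have := congrFun ha j
        rw [hG] at this
        simpa using this
      have hle : LinearMap.range (gabMap F K k a) ≤ LinearMap.ker L :=
        LinearMap.range_le_ker_iff.mpr hz
      have h1 := Submodule.finrank_mono hle
      have h2 := LinearMap.finrank_range_add_finrank_ker (gabMap F K k a)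
      refine gab_zero k a (LinearMap.ker (gabMap F K k a)) (by omega) ?_
      intro x hx
      rw [← gabMap_apply]; exact hx
    have hGsurj : Function.Surjective G := by
      refine (LinearMap.injective_iff_surjective_of_finrank_eq_finrank ?_).mp hGinj
      simp [Module.finrank_pi_fintype, hfin, mul_comm]
    have hMA : ∀ a i j, (M * A a) i j = G a (Fin.castLE hnm.le j) i := by
      intro a i j
      rw [hG]
      simp [L, A, Matrix.mul_apply, Matrix.mulVec, dotProduct]
    rw [Set.eq_univ_iff_forall]
    intro B
    let B' : Fin m → Fin k → F := fun j i => if h : (j : ℕ) < n then B i ⟨j, h⟩ else 1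
    obtain ⟨a, ha⟩ := hGsurj B'
    refine ⟨A a, ⟨⟨a, rfl⟩, ?_⟩, ?_⟩
    · intro h0
      have : a = 0 := hAinj a h0
      subst this
      have := congrFun (congrFun ha ⟨n, hnm⟩) ⟨0, hk⟩
      simp [B'] at this
    · ext i j
      show (M * A a) i j = B i j
      rw [hMA, ha]
      simp [B']
  · have hc : (Set.range A).ncard ≤ Fintype.card F ^ (k * m) := by
      rw [← Set.image_univ]
      refine (Set.ncard_image_le Set.finite_univ).trans ?_
      rw [Set.ncard_univ, Nat.card_fun, Nat.card_fin,
        Module.natCard_eq_pow_finrank (K := F), hfin, Nat.card_eq_fintype_card, ← pow_mul, mul_comm]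
    refine lt_of_lt_of_le ?_ hc
    exact Set.ncard_sdiff_singleton_lt_of_mem ⟨0, hA0⟩ (Set.toFinite _)

lemma lower_part {F : Type*} [Field F] [Fintype F] (k m n : ℕ)
    (hk : 1 ≤ k) (hkn : k ≤ n) (hnm : n < m)
    (𝒜 : Set (Matrix (Fin m) (Fin n) F)) (h𝒜 : IsKDense k 𝒜) :
    Fintype.card F ^ (k * n) < 𝒜.ncard := by
  classical
  have hq1 : 1 < Fintype.card F := Fintype.one_lt_card
  by_contra! hle
  have hcardU : (Set.univ : Set (Matrix (Fin k) (Fin n) F)).ncard = Fintype.card F ^ (k * n) := by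
    rw [Set.ncard_univ]
    change Nat.card (Fin k → Fin n → F) = _
    simp [Nat.card_fun, ← pow_mul, mul_comm]
  -- all multiplication maps are injective on the set
  have hinj : ∀ M : Matrix (Fin k) (Fin m) F, M.rank = k →
      Set.InjOn (fun A => M * A) 𝒜 ∧ Fintype.card F ^ (k * n) ≤ 𝒜.ncard := by
    intro M hM
    have h1 := h𝒜 M hM
    have h2 : Fintype.card F ^ (k * n) ≤ 𝒜.ncard := by
      rw [← hcardU, ← h1]; exact Set.ncard_image_le (Set.toFinite _)
    refine ⟨?_, h2⟩
    apply Set.injOn_of_ncard_image_eq _ (Set.toFinite _)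
    rw [h1, hcardU]; omega
  -- matrices with few nonzero columns are killed by a full rank matrix
  have hkill : ∀ D : Matrix (Fin m) (Fin n) F, (∀ i (j : Fin n), m - k ≤ (j : ℕ) → D i j = 0) →
      ∃ M : Matrix (Fin k) (Fin m) F, M.rank = k ∧ M * D = 0 := by
    intro D hD
    let T : (Fin m → F) →ₗ[F] (Fin (m - k) → F) :=
      LinearMap.pi fun l => if h : (l : ℕ) < n then
        (LinearMap.proj (⟨l, h⟩ : Fin n)) ∘ₗ D.vecMulLinear else 0
    have hT := LinearMap.finrank_range_add_finrank_ker T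
    have hTr := Submodule.finrank_le (LinearMap.range T)
    simp only [Module.finrank_fin_fun] at hT hTr
    have hker : k ≤ Module.finrank F (LinearMap.ker T) := by omega
    obtain ⟨v, hv⟩ := exists_linearIndependent_of_le_finrank hker
    have hv' : LinearIndependent F (fun i => (v i : Fin m → F)) :=
      hv.map' (LinearMap.ker T).subtype (Submodule.ker_subtype _)
    refine ⟨Matrix.of fun i => (v i : Fin m → F), ?_, ?_⟩
    · have := LinearIndependent.rank_matrix (M := Matrix.of fun i => (v i : Fin m → F)) hv'
      simpa using this
    · ext i j
      by_cases hj : m - k ≤ (j : ℕ)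
      · simp [Matrix.mul_apply, hD _ j hj]
      · have h0 : T (v i) = 0 := (v i).2
        have := congrFun h0 ⟨j, by omega⟩
        simpa [T, Matrix.vecMul, Matrix.mul_apply, dotProduct] using this
  -- Singleton-type bound
  let S := {j : Fin n // m - k ≤ (j : ℕ)}
  let R : Matrix (Fin m) (Fin n) F → (Fin m → S → F) := fun A i j => A i j.1
  have hR : Set.InjOn R 𝒜 := by
    intro A hA B hB hAB
    obtain ⟨M, hM, hMD⟩ := hkill (A - B) (by
      intro i j hj
      have := congrFun (congrFun hAB i) ⟨j, hj⟩
      simpa [R, sub_eq_zero] using this)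
    refine (hinj M hM).1 hA hB ?_
    rw [Matrix.mul_sub, sub_eq_zero] at hMD
    exact hMD
  obtain ⟨M, hM, -⟩ := hkill 0 (by simp)
  have hge := (hinj M hM).2
  have hS : Fintype.card S ≤ n - (m - k) := by
    let φ : S → Fin (n - (m - k)) := fun j => ⟨j.1 - (m - k), by
      have := j.2; have := j.1.2; omega⟩
    have : Function.Injective φ := by
      intro x y hxy
      have h1 := congrArg Fin.val hxy
      have hx := x.2
      have hy := y.2
      simp only [φ] at h1
      apply Subtype.ext; apply Fin.ext; omega
    simpa using Fintype.card_le_of_injective φ this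
  have hub : 𝒜.ncard ≤ Fintype.card F ^ (m * (n - (m - k))) := by
    rw [← Set.InjOn.ncard_image hR]
    refine (Set.ncard_le_ncard (Set.subset_univ _) (Set.toFinite _)).trans ?_
    rw [Set.ncard_univ, Nat.card_eq_fintype_card]
    simp only [Fintype.card_fun, ← pow_mul, Fintype.card_fin]
    apply Nat.pow_le_pow_right (by omega)
    rw [mul_comm]
    exact Nat.mul_le_mul_left _ hS
  have hlt : m * (n - (m - k)) < k * n := by
    rcases le_total n (m - k) with h | h
    · rw [Nat.sub_eq_zero_of_le h]
      simp only [mul_zero]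
      exact Nat.mul_pos hk (by omega)
    · obtain ⟨c, rfl⟩ : ∃ c, m = k + c := ⟨m - k, by omega⟩
      obtain ⟨d, rfl⟩ : ∃ d, n = c + d := ⟨n - c, by omega⟩
      have e : c + d - (k + c - k) = d := by omega
      rw [e]
      have hdk : d < k := by omega
      have hc : 0 < c := by omega
      nlinarith
  have := Nat.pow_lt_pow_right hq1 hlt
  omega

/-- For `1 ≤ k ≤ n < m`, the minimum size of a `k`-dense subset of `F^{m×n}` is strictly
between `q^{kn}` and `q^{km}`: (a) every `k`-dense subset has size `> q^{kn}`, and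
(b) there is a `k`-dense subset of size `< q^{km}`. -/
theorem stmt18 {F : Type*} [Field F] [Fintype F] [DecidableEq F] (q k m n : ℕ)
    (hq : Fintype.card F = q) (hk : 1 ≤ k) (hkn : k ≤ n) (hnm : n < m) :
    (∀ 𝒜 : Set (Matrix (Fin m) (Fin n) F), IsKDense k 𝒜 → q ^ (k * n) < 𝒜.ncard) ∧
      (∃ 𝒜 : Set (Matrix (Fin m) (Fin n) F), IsKDense k 𝒜 ∧ 𝒜.ncard < q ^ (k * m)) := by
  subst hq
  exact ⟨fun 𝒜 h => lower_part k m n hk hkn hnm 𝒜 h, upper_part k m n hk hkn hnm⟩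
end

section
/- Let F = 𝔽₂ be the field with 2 elements. (i) Every 1-dense subset 𝒜 of the space F^{3×2} of 3×2 matrices over F satisfies |𝒜| ≥ 6, and there exists a 1-dense subset of F^{3×2} of size exactly 6; i.e. the minimum size of a 1-dense subset of 𝔽₂^{3×2} is 6. (ii) Every 2-dense subset 𝒜 of F^{3×2} satisfies |𝒜| ≥ 22, and there exists a 2-dense subset of F^{3×2} of size exactly 22; i.e. the minimum size of a 2-dense subset of 𝔽₂^{3×2} is 22. -/
open Matrix

/-- A block: bit mask together with the list of its points. -/
abbrev Blk := ℕ × List ℕ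

/-- Forces evaluation of a natural number before continuing. -/
def force {α : Type} (n : ℕ) (f : ℕ → α) : α :=
  Nat.rec (f 0) (fun k _ => f (Nat.succ k)) n

theorem force_eq {α : Type} (n : ℕ) (f : ℕ → α) : force n f = f n := by
  cases n <;> rfl

/-- The block is not yet hit by the chosen points. -/
def isUn (ch : ℕ) (b : Blk) : Bool := Nat.beq (Nat.land b.1 ch) 0

/-- Membership in a bit mask. -/
def bit (m i : ℕ) : Bool := Nat.beq (Nat.land (Nat.shiftRight m i) 1) 1

/-- Number of blocks not yet hit. -/
def cntUn (ch : ℕ) (c : List Blk) : ℕ :=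
  List.rec (motive := fun _ => ℕ) 0
    (fun b _ ih => Bool.rec ih (Nat.succ ih) (isUn ch b)) c

/-- Number of points not excluded. -/
def cntAv (ex : ℕ) (c : List ℕ) : ℕ :=
  List.rec (motive := fun _ => ℕ) 0
    (fun p _ ih => Bool.rec (Nat.succ ih) ih (bit ex p)) c

/-- Adds all hit blocks to the mask. -/
def orHit (ch ex : ℕ) (c : List Blk) : ℕ :=
  List.rec (motive := fun _ => ℕ) ex
    (fun b _ ih => Bool.rec (Nat.lor ih b.1) ih (isUn ch b)) c

/-- Excludes the remaining points of hit blocks in classes without slack. -/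
def tight (lim n ch ex : ℕ) (cs : List (List Blk)) : ℕ :=
  List.rec (motive := fun _ => ℕ) ex
    (fun c _ ih => Bool.rec ih (orHit ch ih c) (Nat.beq (Nat.add n (cntUn ch c)) lim)) cs

/-- Chooses an unhit block with few available points. -/
def pick (ch ex : ℕ) (c : List Blk) : ℕ → Option (List ℕ) → Option (List ℕ) :=
  List.rec (motive := fun _ => ℕ → Option (List ℕ) → Option (List ℕ)) (fun _ o => o)
    (fun b _ ih k o => Bool.rec (ih k o)
      (force (cntAv ex b.2) fun j =>
        Bool.rec (Bool.rec (ih k o) (ih j (some b.2)) (Nat.ble (Nat.succ j) k))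
          (some b.2) (Nat.ble j 1)) (isUn ch b)) c

/-- Branches over the available points of a block. -/
def tryPts (f : ℕ → ℕ → Bool) (ch : ℕ) (ps : List ℕ) : ℕ → Bool :=
  List.rec (motive := fun _ => ℕ → Bool) (fun _ => true)
    (fun p _ ih ex => Bool.rec
      (Bool.rec false (force (Nat.lor ex (Nat.pow 2 p)) ih)
        (force (Nat.lor ch (Nat.pow 2 p)) fun ch' => f ch' ex)) (ih ex) (bit ex p)) ps

/-- `ch` contains the mask `g`. -/
def contains (ch g : ℕ) : Bool := Nat.beq (Nat.land g ch) g

/-- Counting bound violated. -/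
def tooMany (lim n ch : ℕ) (c : List Blk) : Bool := Nat.ble (Nat.succ lim) (Nat.add n (cntUn ch c))

/-- Disjunction over a list. -/
def anyL {α : Type} (f : α → Bool) (l : List α) : Bool :=
  List.rec (motive := fun _ => Bool) false (fun a _ ih => Bool.rec ih true (f a)) l

/-- Exhaustive search: every set with at most `lim` points hitting all blocks and extending `ch`
contains one of the `goals`. -/
def search (cl : List (List Blk)) (bl : List Blk) (goals : List ℕ) (lim k : ℕ) :
    ℕ → ℕ → ℕ → Bool :=
  Nat.rec (motive := fun _ => ℕ → ℕ → ℕ → Bool) (fun _ _ _ => false)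
    (fun _ ih n ch ex =>
      Bool.rec (Bool.rec
        (force (tight lim n ch ex cl) fun ex' =>
          Option.rec (motive := fun _ => Bool) false
            (fun ps => tryPts (ih (Nat.succ n)) ch ps ex')
            (pick ch ex' bl 99 none))
        true (anyL (tooMany lim n ch) cl)) true (anyL (contains ch) goals)) k

/-- Multiplication in the field with four elements `{0,1,2,3}` (addition is xor). -/
def mul4 (s x : ℕ) : ℕ :=
  if s = 0 ∨ x = 0 then 0 else (s - 1 + (x - 1)) % 3 + 1

/-- Points of a transversal. -/
def ptsT (z s c : ℕ) : List ℕ :=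
  [16 * z + (mul4 s 0 ^^^ c), 16 * z + 4 + (mul4 s 1 ^^^ c), 16 * z + 8 + (mul4 s 2 ^^^ c),
    16 * z + 12 + (mul4 s 3 ^^^ c)]

/-- Bit mask of a list of points. -/
def maskOf (l : List ℕ) : ℕ := l.foldr (fun p m => m ||| 2 ^ p) 0

def mT (z s c : ℕ) : ℕ := maskOf (ptsT z s c)

def goalsOf (z : ℕ) : List ℕ :=
  [mT z 2 0, mT z 2 1, mT z 2 2, mT z 2 3, mT z 3 0, mT z 3 1, mT z 3 2, mT z 3 3]

theorem bit_eq (m i : ℕ) : bit m i = m.testBit i := by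
  have h1 : Nat.land (Nat.shiftRight m i) 1 = (m >>> i) % 2 := Nat.and_one_is_mod _
  unfold bit
  rw [h1, Nat.testBit, Nat.one_and_eq_mod_two]
  rcases Nat.mod_two_eq_zero_or_one (m >>> i) with h | h <;> rw [h] <;> rfl

theorem testBit_maskOf (l : List ℕ) (i : ℕ) : (maskOf l).testBit i = true ↔ i ∈ l := by
  induction l with
  | nil => simp [maskOf]
  | cons a l ih =>
    have : maskOf (a :: l) = maskOf l ||| 2 ^ a := rfl
    rw [this, Nat.testBit_or, Bool.or_eq_true, ih, Nat.testBit_two_pow, List.mem_cons]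
    simp only [decide_eq_true_eq]
    tauto

theorem isUn_iff {ch : ℕ} {C : Finset ℕ} (hC : ∀ i, ch.testBit i = true ↔ i ∈ C) {b : Blk}
    (hb : b.1 = maskOf b.2) : isUn ch b = true ↔ ∀ p ∈ b.2, p ∉ C := by
  have h0 : isUn ch b = true ↔ b.1 &&& ch = 0 := by
    unfold isUn
    exact Nat.beq_eq ▸ Iff.rfl
  rw [h0]
  constructor
  · intro h p hp hpC
    have h1 : (b.1 &&& ch).testBit p = true := by
      rw [Nat.testBit_and, Bool.and_eq_true]
      exact ⟨by rw [hb]; exact (testBit_maskOf _ _).2 hp, (hC p).2 hpC⟩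
    rw [h] at h1
    simp at h1
  · intro h
    apply Nat.eq_of_testBit_eq
    intro i
    rw [Nat.testBit_and, Nat.zero_testBit]
    by_contra hne
    rw [Bool.not_eq_false, Bool.and_eq_true] at hne
    exact h i ((testBit_maskOf _ _).1 (hb ▸ hne.1)) ((hC i).1 hne.2)

theorem cntUn_eq (ch : ℕ) (c : List Blk) : cntUn ch c = (c.filter (isUn ch)).length := by
  induction c with
  | nil => rfl
  | cons b c ih =>
    have h : cntUn ch (b :: c) = Bool.rec (cntUn ch c) (Nat.succ (cntUn ch c)) (isUn ch b) := rfl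
    rw [h]
    cases hb : isUn ch b
    · rw [List.filter_cons_of_neg (by simp [hb]), ← ih]
    · rw [List.filter_cons_of_pos (by simp [hb]), List.length_cons, ← ih]

theorem length_le (A : Finset ℕ) (l : List Blk)
    (hp : l.Pairwise fun b b' => ∀ p ∈ b.2, p ∉ b'.2)
    (hit : ∀ b ∈ l, ∃ p ∈ b.2, p ∈ A) :
    l.length ≤ (A.filter fun i => ∃ b ∈ l, i ∈ b.2).card := by
  induction l with
  | nil => simp
  | cons b l ih =>
    rw [List.pairwise_cons] at hp
    obtain ⟨p, hpb, hpA⟩ := hit b (by simp)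
    have h1 := ih hp.2 fun b' hb' => hit b' (by simp [hb'])
    have hnot : p ∉ A.filter fun i => ∃ b ∈ l, i ∈ b.2 := by
      intro h
      rw [Finset.mem_filter] at h
      obtain ⟨_, b', hb', hpb'⟩ := h
      exact hp.1 b' hb' p hpb hpb'
    rw [List.length_cons]
    calc l.length + 1 ≤ (A.filter fun i => ∃ b ∈ l, i ∈ b.2).card + 1 := by omega
      _ = (insert p (A.filter fun i => ∃ b ∈ l, i ∈ b.2)).card :=
        (Finset.card_insert_of_notMem hnot).symm
      _ ≤ _ := by
        apply Finset.card_le_card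
        intro q hq
        rw [Finset.mem_insert, Finset.mem_filter] at hq
        rw [Finset.mem_filter]
        rcases hq with rfl | ⟨h2, b', hb', hq⟩
        · exact ⟨hpA, b, by simp, hpb⟩
        · exact ⟨h2, b', by simp [hb'], hq⟩

/-- Well-formedness of the data of a parallel class. -/
def GoodClass (c : List Blk) : Prop :=
  (∀ b ∈ c, b.1 = maskOf b.2) ∧ c.Pairwise fun b b' => ∀ p ∈ b.2, p ∉ b'.2

instance (c : List Blk) : Decidable (GoodClass c) := by unfold GoodClass; infer_instance

theorem bound_aux {A C : Finset ℕ} {ch : ℕ} (hCA : C ⊆ A)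
    (hC : ∀ i, ch.testBit i = true ↔ i ∈ C) {c : List Blk} (hc : GoodClass c)
    (hit : ∀ b ∈ c, ∃ p ∈ b.2, p ∈ A) (S : Finset ℕ)
    (hS : ∀ p ∈ A, p ∉ C → (∃ b ∈ c, isUn ch b = true ∧ p ∈ b.2) → p ∈ S) :
    cntUn ch c ≤ S.card := by
  rw [cntUn_eq]
  have h := length_le (A \ C) (c.filter (isUn ch)) (hc.2.filter _) (by
    intro b hb
    rw [List.mem_filter] at hb
    obtain ⟨p, hp, hpA⟩ := hit b hb.1
    exact ⟨p, hp, Finset.mem_sdiff.2 ⟨hpA, (isUn_iff hC (hc.1 b hb.1)).1 hb.2 p hp⟩⟩)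
  refine h.trans (Finset.card_le_card ?_)
  intro p hp
  rw [Finset.mem_filter, Finset.mem_sdiff] at hp
  obtain ⟨⟨h1, h2⟩, b, hb, hpb⟩ := hp
  rw [List.mem_filter] at hb
  exact hS p h1 h2 ⟨b, hb.1, hb.2, hpb⟩

theorem bound_card {A C : Finset ℕ} {ch : ℕ} (hCA : C ⊆ A)
    (hC : ∀ i, ch.testBit i = true ↔ i ∈ C) {c : List Blk} (hc : GoodClass c)
    (hit : ∀ b ∈ c, ∃ p ∈ b.2, p ∈ A) : C.card + cntUn ch c ≤ A.card := by
  have h := bound_aux hCA hC hc hit (A \ C) fun p h1 h2 _ => Finset.mem_sdiff.2 ⟨h1, h2⟩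
  have h2 := Finset.card_sdiff_add_card_eq_card hCA
  omega

theorem bound_tight {A C : Finset ℕ} {ch : ℕ} (hCA : C ⊆ A)
    (hC : ∀ i, ch.testBit i = true ↔ i ∈ C) {c : List Blk} (hc : GoodClass c)
    (hit : ∀ b ∈ c, ∃ p ∈ b.2, p ∈ A) (hle : A.card ≤ C.card + cntUn ch c)
    {b : Blk} (hb : b ∈ c) (hbu : isUn ch b = false) {p : ℕ} (hp : p ∈ b.2) (hpA : p ∈ A) :
    p ∈ C := by
  by_contra hpC
  have hpm : p ∈ A \ C := Finset.mem_sdiff.2 ⟨hpA, hpC⟩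
  have h := bound_aux hCA hC hc hit ((A \ C).erase p) (by
    rintro q h1 h2 ⟨b', hb', hu, hq⟩
    refine Finset.mem_erase.2 ⟨?_, Finset.mem_sdiff.2 ⟨h1, h2⟩⟩
    rintro rfl
    have hne : b ≠ b' := by
      rintro rfl
      rw [hbu] at hu
      cases hu
    have hsym : ∀ ⦃x⦄, x ∈ c → ∀ ⦃y⦄, y ∈ c → x ≠ y → ∀ q ∈ x.2, q ∉ y.2 := by
      have : Std.Symm fun x y : Blk => x ≠ y → ∀ q ∈ x.2, q ∉ y.2 :=
        ⟨fun x y hxy hne q h1 h2 => hxy hne.symm q h2 h1⟩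
      refine List.Pairwise.forall_of_forall (R := fun x y : Blk => x ≠ y → ∀ q ∈ x.2, q ∉ y.2)
        ?_ ?_
      · intro x _ h
        exact absurd rfl h
      · exact List.Pairwise.imp (fun {x y} h (_ : x ≠ y) => h) hc.2
    exact hsym hb hb' hne q hp hq)
  rw [Finset.card_erase_of_mem hpm] at h
  have h2 := Finset.card_sdiff_add_card_eq_card hCA
  have h3 : 0 < (A \ C).card := Finset.card_pos.2 ⟨p, hpm⟩
  omega

theorem orHit_sound {A C : Finset ℕ} {ch ex : ℕ} (c : List Blk)
    (hm : ∀ b ∈ c, b.1 = maskOf b.2)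
    (hex : ∀ i ∈ A, ex.testBit i = true → i ∈ C)
    (h : ∀ b ∈ c, isUn ch b = false → ∀ p ∈ b.2, p ∈ A → p ∈ C) :
    ∀ i ∈ A, (orHit ch ex c).testBit i = true → i ∈ C := by
  induction c with
  | nil => exact hex
  | cons b c ih =>
    have ih' := ih (fun b' hb' => hm b' (by simp [hb'])) (fun b' hb' => h b' (by simp [hb']))
    have e : orHit ch ex (b :: c) =
      Bool.rec (orHit ch ex c ||| b.1) (orHit ch ex c) (isUn ch b) := rfl
    rw [e]
    cases hb : isUn ch b
    · intro i hi hbit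
      change (orHit ch ex c ||| b.1).testBit i = true at hbit
      rw [Nat.testBit_or, Bool.or_eq_true] at hbit
      rcases hbit with hbit | hbit
      · exact ih' i hi hbit
      · rw [hm b (by simp), testBit_maskOf] at hbit
        exact h b (by simp) hb i hbit hi
    · exact ih'

theorem tight_sound {A C : Finset ℕ} {lim n ch ex : ℕ} (cs : List (List Blk))
    (hA : A.card ≤ lim) (hn : C.card = n) (hCA : C ⊆ A)
    (hC : ∀ i, ch.testBit i = true ↔ i ∈ C)
    (hg : ∀ c ∈ cs, GoodClass c)
    (hit : ∀ c ∈ cs, ∀ b ∈ c, ∃ p ∈ b.2, p ∈ A)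
    (hex : ∀ i ∈ A, ex.testBit i = true → i ∈ C) :
    ∀ i ∈ A, (tight lim n ch ex cs).testBit i = true → i ∈ C := by
  induction cs with
  | nil => exact hex
  | cons c cs ih =>
    have ih' := ih (fun c hc => hg c (by simp [hc])) (fun c hc => hit c (by simp [hc]))
    have e : tight lim n ch ex (c :: cs) =
      Bool.rec (tight lim n ch ex cs) (orHit ch (tight lim n ch ex cs) c)
        (Nat.beq (n + cntUn ch c) lim) := rfl
    rw [e]
    cases hb : Nat.beq (n + cntUn ch c) lim
    · exact ih'
    · have hb' : n + cntUn ch c = lim := Nat.eq_of_beq_eq_true hb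
      have hgc := hg c (by simp)
      refine orHit_sound c hgc.1 ih' ?_
      intro b hbc hu p hp hpA
      exact bound_tight hCA hC hgc (hit c (by simp)) (by omega) hbc hu hp hpA

theorem pick_sound {ch ex : ℕ} (c : List Blk) : ∀ (k : ℕ) (o : Option (List ℕ)) (ps : List ℕ),
    pick ch ex c k o = some ps → o = some ps ∨ ∃ b ∈ c, isUn ch b = true ∧ b.2 = ps := by
  induction c with
  | nil =>
    intro k o ps h
    exact Or.inl h
  | cons b c ih =>
    intro k o ps h
    have e : pick ch ex (b :: c) k o = Bool.rec (pick ch ex c k o)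
      (force (cntAv ex b.2) fun j =>
        Bool.rec (Bool.rec (pick ch ex c k o) (pick ch ex c j (some b.2)) (Nat.ble (Nat.succ j) k))
          (some b.2) (Nat.ble j 1)) (isUn ch b) := rfl
    rw [e, force_eq] at h
    have key : ∀ k o, pick ch ex c k o = some ps →
        o = some ps ∨ ∃ b' ∈ b :: c, isUn ch b' = true ∧ b'.2 = ps := by
      intro k o h
      rcases ih k o ps h with h | ⟨b', hb', h⟩
      · exact Or.inl h
      · exact Or.inr ⟨b', by simp [hb'], h⟩
    cases hb : isUn ch b <;> rw [hb] at h
    · exact key k o h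
    · have hgot : some b.2 = some ps → o = some ps ∨ ∃ b' ∈ b :: c, isUn ch b' = true ∧ b'.2 = ps :=
        fun h => Or.inr ⟨b, by simp, hb, Option.some.inj h⟩
      cases h1 : Nat.ble (cntAv ex b.2) 1 <;> simp only [h1] at h
      · cases h2 : Nat.ble (Nat.succ (cntAv ex b.2)) k <;> simp only [h2] at h
        · exact key k o h
        · rcases key _ _ h with h | h
          · exact hgot h
          · exact Or.inr h
      · exact hgot h

theorem tryPts_sound {A C : Finset ℕ} {ch : ℕ} (hC : ∀ i, ch.testBit i = true ↔ i ∈ C)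
    (f : ℕ → ℕ → Bool) (P : Prop) (hCA : C ⊆ A)
    (hf : ∀ ch' ex p, p ∈ A → p ∉ C → (∀ i, ch'.testBit i = true ↔ i ∈ insert p C) →
      (∀ i ∈ A, ex.testBit i = true → i ∈ C) → f ch' ex = true → P)
    (ps : List ℕ) (hun : ∀ p ∈ ps, p ∉ C) : ∀ ex, (∀ i ∈ A, ex.testBit i = true → i ∈ C) →
      (∃ p ∈ ps, p ∈ A) → tryPts f ch ps ex = true → P := by
  induction ps with
  | nil =>
    rintro ex _ ⟨p, hp, _⟩
    simp at hp
  | cons p ps ih =>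
    intro ex hex hhit h
    have ih' := ih fun q hq => hun q (by simp [hq])
    have hpC := hun p (by simp)
    have e : tryPts f ch (p :: ps) ex = Bool.rec
      (Bool.rec false (force (ex ||| 2 ^ p) (tryPts f ch ps))
        (force (ch ||| 2 ^ p) fun ch' => f ch' ex)) (tryPts f ch ps ex) (bit ex p) := rfl
    rw [e, force_eq, force_eq, bit_eq] at h
    by_cases hpA : p ∈ A
    · cases hb : ex.testBit p
      · simp only [hb] at h
        cases h1 : f (ch ||| 2 ^ p) ex <;> simp only [h1] at h
        · cases h
        · refine hf _ ex p hpA hpC ?_ hex h1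
          intro i
          rw [Nat.testBit_or, Bool.or_eq_true, hC, Nat.testBit_two_pow, Finset.mem_insert]
          simp only [decide_eq_true_eq]
          tauto
      · exact absurd (hex p hpA hb) hpC
    · have hhit' : ∃ q ∈ ps, q ∈ A := by
        obtain ⟨q, hq, hqA⟩ := hhit
        rcases List.mem_cons.1 hq with rfl | hq
        · exact absurd hqA hpA
        · exact ⟨q, hq, hqA⟩
      cases hb : ex.testBit p <;> simp only [hb] at h
      · cases h1 : f (ch ||| 2 ^ p) ex <;> simp only [h1] at h
        · cases h
        · refine ih' _ ?_ hhit' h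
          intro i hi hbit
          rw [Nat.testBit_or, Bool.or_eq_true, Nat.testBit_two_pow] at hbit
          rcases hbit with hbit | hbit
          · exact hex i hi hbit
          · simp only [decide_eq_true_eq] at hbit
            subst hbit
            exact absurd hi hpA
      · exact ih' ex hex hhit' h

theorem anyL_sound {α : Type} (f : α → Bool) (l : List α) (h : anyL f l = true) :
    ∃ a ∈ l, f a = true := by
  induction l with
  | nil => cases h
  | cons a l ih =>
    have e : anyL f (a :: l) = Bool.rec (anyL f l) true (f a) := rfl
    rw [e] at h
    cases ha : f a
    · rw [ha] at h
      obtain ⟨b, hb, h⟩ := ih h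
      exact ⟨b, by simp [hb], h⟩
    · exact ⟨a, by simp, ha⟩

theorem search_sound (cl : List (List Blk)) (goals : List ℕ) (lim : ℕ) (A : Finset ℕ)
    (hA : A.card ≤ lim) (hg : ∀ c ∈ cl, GoodClass c)
    (hit : ∀ b ∈ cl.flatten, ∃ p ∈ b.2, p ∈ A) (k : ℕ) : ∀ (n ch ex : ℕ) (C : Finset ℕ),
    C.card = n → C ⊆ A → (∀ i, ch.testBit i = true ↔ i ∈ C) →
    (∀ i ∈ A, ex.testBit i = true → i ∈ C) →
    search cl cl.flatten goals lim k n ch ex = true →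
    ∃ g ∈ goals, ∀ i, g.testBit i = true → i ∈ A := by
  have hit' : ∀ c ∈ cl, ∀ b ∈ c, ∃ p ∈ b.2, p ∈ A := fun c hc b hb =>
    hit b (List.mem_flatten.2 ⟨c, hc, hb⟩)
  induction k with
  | zero =>
    intro n ch ex C _ _ _ _ h
    cases h
  | succ k ih =>
    intro n ch ex C hn hCA hC hex h
    have e : search cl cl.flatten goals lim (k + 1) n ch ex =
      Bool.rec (Bool.rec
        (force (tight lim n ch ex cl) fun ex' =>
          Option.rec (motive := fun _ => Bool) false
            (fun ps => tryPts (search cl cl.flatten goals lim k (Nat.succ n)) ch ps ex')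
            (pick ch ex' cl.flatten 99 none))
        true (anyL (tooMany lim n ch) cl)) true (anyL (contains ch) goals) := rfl
    rw [e, force_eq] at h
    cases h1 : anyL (contains ch) goals
    · rw [h1] at h
      cases h2 : anyL (tooMany lim n ch) cl
      · rw [h2] at h
        have hex' := tight_sound cl hA hn hCA hC hg hit' hex
        cases h3 : pick ch (tight lim n ch ex cl) cl.flatten 99 none with
        | none =>
          simp only [h3] at h
          cases h
        | some ps =>
          simp only [h3] at h
          rcases pick_sound _ _ _ _ h3 with h4 | ⟨b, hb, hu, rfl⟩
          · cases h4
          · obtain ⟨c, hc, hbc⟩ := List.mem_flatten.1 hb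
            refine tryPts_sound hC _ _ hCA ?_ b.2
              ((isUn_iff hC ((hg c hc).1 b hbc)).1 hu) _ hex' (hit b hb) h
            intro ch' ex1 p hpA hpC hch' hex1 hs
            refine ih _ ch' ex1 (insert p C) ?_ ?_ hch' ?_ hs
            · rw [Finset.card_insert_of_notMem hpC, hn]
            · exact Finset.insert_subset hpA hCA
            · intro i hi hb
              exact Finset.mem_insert_of_mem (hex1 i hi hb)
      · obtain ⟨c, hc, h3⟩ := anyL_sound _ _ h2
        have h4 : lim + 1 ≤ n + cntUn ch c := Nat.le_of_ble_eq_true h3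
        have h5 := bound_card hCA hC (hg c hc) (hit' c hc)
        omega
    · obtain ⟨g, hgg, h3⟩ := anyL_sound _ _ h1
      refine ⟨g, hgg, fun i hi => hCA ((hC i).1 ?_)⟩
      have h4 : g &&& ch = g := Nat.eq_of_beq_eq_true h3
      rw [← h4, Nat.testBit_and, Bool.and_eq_true] at hi
      exact hi.2

/-- The parallel classes of blocks for 2-density. -/
def clsTwo : List (List Blk) := [
  [(15, [0, 1, 2, 3]),
   (240, [4, 5, 6, 7]),
   (3840, [8, 9, 10, 11]),
   (61440, [12, 13, 14, 15]),
   (983040, [16, 17, 18, 19]),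
   (15728640, [20, 21, 22, 23]),
   (251658240, [24, 25, 26, 27]),
   (4026531840, [28, 29, 30, 31]),
   (64424509440, [32, 33, 34, 35]),
   (1030792151040, [36, 37, 38, 39]),
   (16492674416640, [40, 41, 42, 43]),
   (263882790666240, [44, 45, 46, 47]),
   (4222124650659840, [48, 49, 50, 51]),
   (67553994410557440, [52, 53, 54, 55]),
   (1080863910568919040, [56, 57, 58, 59]),
   (17293822569102704640, [60, 61, 62, 63])],
  [(4369, [0, 4, 8, 12]),
   (8738, [1, 5, 9, 13]),
   (17476, [2, 6, 10, 14]),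
   (34952, [3, 7, 11, 15]),
   (286326784, [16, 20, 24, 28]),
   (572653568, [17, 21, 25, 29]),
   (1145307136, [18, 22, 26, 30]),
   (2290614272, [19, 23, 27, 31]),
   (18764712116224, [32, 36, 40, 44]),
   (37529424232448, [33, 37, 41, 45]),
   (75058848464896, [34, 38, 42, 46]),
   (150117696929792, [35, 39, 43, 47]),
   (1229764173248856064, [48, 52, 56, 60]),
   (2459528346497712128, [49, 53, 57, 61]),
   (4919056692995424256, [50, 54, 58, 62]),
   (9838113385990848512, [51, 55, 59, 63])],
  [(33825, [0, 5, 10, 15]),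
   (18450, [1, 4, 11, 14]),
   (8580, [2, 7, 8, 13]),
   (4680, [3, 6, 9, 12]),
   (2216755200, [16, 21, 26, 31]),
   (1209139200, [17, 20, 27, 30]),
   (562298880, [18, 23, 24, 29]),
   (306708480, [19, 22, 25, 28]),
   (145277268787200, [32, 37, 42, 47]),
   (79242146611200, [33, 36, 43, 46]),
   (36850819399680, [34, 39, 40, 45]),
   (20100446945280, [35, 38, 41, 44]),
   (9520891087237939200, [48, 53, 58, 63]),
   (5193213320311603200, [49, 52, 59, 62]),
   (2415055300177428480, [50, 55, 56, 61]),
   (1317302891005870080, [51, 54, 57, 60])],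
  [(281479271743489, [0, 16, 32, 48]),
   (562958543486978, [1, 17, 33, 49]),
   (1125917086973956, [2, 18, 34, 50]),
   (2251834173947912, [3, 19, 35, 51]),
   (4503668347895824, [4, 20, 36, 52]),
   (9007336695791648, [5, 21, 37, 53]),
   (18014673391583296, [6, 22, 38, 54]),
   (36029346783166592, [7, 23, 39, 55]),
   (72058693566333184, [8, 24, 40, 56]),
   (144117387132666368, [9, 25, 41, 57]),
   (288234774265332736, [10, 26, 42, 58]),
   (576469548530665472, [11, 27, 43, 59]),
   (1152939097061330944, [12, 28, 44, 60]),
   (2305878194122661888, [13, 29, 45, 61]),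
   (4611756388245323776, [14, 30, 46, 62]),
   (9223512776490647552, [15, 31, 47, 63])],
  [(2251816993685505, [0, 17, 34, 51]),
   (1125934266646530, [1, 16, 35, 50]),
   (562954248912900, [2, 19, 32, 49]),
   (281483566907400, [3, 18, 33, 48]),
   (36029071898968080, [4, 21, 38, 55]),
   (18014948266344480, [5, 20, 39, 54]),
   (9007267982606400, [6, 23, 36, 53]),
   (4503737070518400, [7, 22, 37, 52]),
   (576465150383489280, [8, 25, 42, 59]),
   (288239172261511680, [9, 24, 43, 58]),
   (144116287721702400, [10, 27, 40, 57]),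
   (72059793128294400, [11, 26, 41, 56]),
   (9223442406135828480, [12, 29, 46, 63]),
   (4611826756184186880, [13, 28, 47, 62]),
   (2305860603547238400, [14, 31, 44, 61]),
   (1152956690052710400, [15, 30, 45, 60])],
  [(1152922604119523329, [0, 20, 40, 60]),
   (2305845208239046658, [1, 21, 41, 61]),
   (4611690416478093316, [2, 22, 42, 62]),
   (9223380832956186632, [3, 23, 43, 63]),
   (72075186224037904, [4, 16, 44, 56]),
   (144150372448075808, [5, 17, 45, 57]),
   (288300744896151616, [6, 18, 46, 58]),
   (576601489792303232, [7, 19, 47, 59]),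
   (4503604190773504, [8, 28, 32, 52]),
   (9007208381547008, [9, 29, 33, 53]),
   (18014416763094016, [10, 30, 34, 54]),
   (36028833526188032, [11, 31, 35, 55]),
   (281543712968704, [12, 24, 36, 48]),
   (563087425937408, [13, 25, 37, 49]),
   (1126174851874816, [14, 26, 38, 50]),
   (2252349703749632, [15, 27, 39, 51])],
  [(9223376434903384065, [0, 21, 42, 63]),
   (4611694814521458690, [1, 20, 43, 62]),
   (2305844108733710340, [2, 23, 40, 61]),
   (1152923703634296840, [3, 22, 41, 60]),
   (576531121047732240, [4, 17, 46, 59]),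
   (288371113640132640, [5, 16, 47, 58]),
   (144132780262424640, [6, 19, 44, 57]),
   (72092778410279040, [7, 18, 45, 56]),
   (36028814735704320, [8, 29, 34, 55]),
   (18014433137656320, [9, 28, 35, 54]),
   (9007205697192960, [10, 31, 32, 53]),
   (4503609291048960, [11, 30, 33, 52]),
   (2252074725150720, [12, 25, 38, 51]),
   (1126449679441920, [13, 24, 39, 50]),
   (563018807132160, [14, 27, 36, 49]),
   (281612482805760, [15, 26, 37, 48])]]

/-- The blocks inside one slice. -/
def clsSlice0 : List (List Blk) := [
  [(15, [0, 1, 2, 3]),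
   (240, [4, 5, 6, 7]),
   (3840, [8, 9, 10, 11]),
   (61440, [12, 13, 14, 15])],
  [(4369, [0, 4, 8, 12]),
   (8738, [1, 5, 9, 13]),
   (17476, [2, 6, 10, 14]),
   (34952, [3, 7, 11, 15])],
  [(33825, [0, 5, 10, 15]),
   (18450, [1, 4, 11, 14]),
   (8580, [2, 7, 8, 13]),
   (4680, [3, 6, 9, 12])]]

/-- The blocks inside one slice. -/
def clsSlice1 : List (List Blk) := [
  [(983040, [16, 17, 18, 19]),
   (15728640, [20, 21, 22, 23]),
   (251658240, [24, 25, 26, 27]),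
   (4026531840, [28, 29, 30, 31])],
  [(286326784, [16, 20, 24, 28]),
   (572653568, [17, 21, 25, 29]),
   (1145307136, [18, 22, 26, 30]),
   (2290614272, [19, 23, 27, 31])],
  [(2216755200, [16, 21, 26, 31]),
   (1209139200, [17, 20, 27, 30]),
   (562298880, [18, 23, 24, 29]),
   (306708480, [19, 22, 25, 28])]]

/-- The blocks inside one slice. -/
def clsSlice2 : List (List Blk) := [
  [(64424509440, [32, 33, 34, 35]),
   (1030792151040, [36, 37, 38, 39]),
   (16492674416640, [40, 41, 42, 43]),
   (263882790666240, [44, 45, 46, 47])],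
  [(18764712116224, [32, 36, 40, 44]),
   (37529424232448, [33, 37, 41, 45]),
   (75058848464896, [34, 38, 42, 46]),
   (150117696929792, [35, 39, 43, 47])],
  [(145277268787200, [32, 37, 42, 47]),
   (79242146611200, [33, 36, 43, 46]),
   (36850819399680, [34, 39, 40, 45]),
   (20100446945280, [35, 38, 41, 44])]]

/-- The blocks inside one slice. -/
def clsSlice3 : List (List Blk) := [
  [(4222124650659840, [48, 49, 50, 51]),
   (67553994410557440, [52, 53, 54, 55]),
   (1080863910568919040, [56, 57, 58, 59]),
   (17293822569102704640, [60, 61, 62, 63])],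
  [(1229764173248856064, [48, 52, 56, 60]),
   (2459528346497712128, [49, 53, 57, 61]),
   (4919056692995424256, [50, 54, 58, 62]),
   (9838113385990848512, [51, 55, 59, 63])],
  [(9520891087237939200, [48, 53, 58, 63]),
   (5193213320311603200, [49, 52, 59, 62]),
   (2415055300177428480, [50, 55, 56, 61]),
   (1317302891005870080, [51, 54, 57, 60])]]

/-- The parallel classes of blocks for 1-density. -/
def clsOne : List (List Blk) := [
  [(1229782938247303441, [0, 4, 8, 12, 16, 20, 24, 28, 32, 36, 40, 44, 48, 52, 56, 60]),
   (2459565876494606882, [1, 5, 9, 13, 17, 21, 25, 29, 33, 37, 41, 45, 49, 53, 57, 61]),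
   (4919131752989213764, [2, 6, 10, 14, 18, 22, 26, 30, 34, 38, 42, 46, 50, 54, 58, 62]),
   (9838263505978427528, [3, 7, 11, 15, 19, 23, 27, 31, 35, 39, 43, 47, 51, 55, 59, 63])],
  [(4222189076152335, [0, 1, 2, 3, 16, 17, 18, 19, 32, 33, 34, 35, 48, 49, 50, 51]),
   (67555025218437360, [4, 5, 6, 7, 20, 21, 22, 23, 36, 37, 38, 39, 52, 53, 54, 55]),
   (1080880403494997760, [8, 9, 10, 11, 24, 25, 26, 27, 40, 41, 42, 43, 56, 57, 58, 59]),
   (17294086455919964160, [12, 13, 14, 15, 28, 29, 30, 31, 44, 45, 46, 47, 60, 61, 62, 63])],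
  [(9521036366723515425, [0, 5, 10, 15, 16, 21, 26, 31, 32, 37, 42, 47, 48, 53, 58, 63]),
   (5193292563667372050, [1, 4, 11, 14, 17, 20, 27, 30, 33, 36, 43, 46, 49, 52, 59, 62]),
   (2415092151559135620, [2, 7, 8, 13, 18, 23, 24, 29, 34, 39, 40, 45, 50, 55, 56, 61]),
   (1317322991759528520, [3, 6, 9, 12, 19, 22, 25, 28, 35, 38, 41, 44, 51, 54, 57, 60])],
  [(65535, [0, 1, 2, 3, 4, 5, 6, 7, 8, 9, 10, 11, 12, 13, 14, 15]),
   (4294901760, [16, 17, 18, 19, 20, 21, 22, 23, 24, 25, 26, 27, 28, 29, 30, 31]),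
   (281470681743360, [32, 33, 34, 35, 36, 37, 38, 39, 40, 41, 42, 43, 44, 45, 46, 47]),
   (18446462598732840960, [48, 49, 50, 51, 52, 53, 54, 55, 56, 57, 58, 59, 60, 61, 62, 63])],
  [(9838188445411971345, [0, 4, 8, 12, 17, 21, 25, 29, 34, 38, 42, 46, 51, 55, 59, 63]),
   (4919206810978689570, [1, 5, 9, 13, 16, 20, 24, 28, 35, 39, 43, 47, 50, 54, 58, 62]),
   (2459547113500460100, [2, 6, 10, 14, 19, 23, 27, 31, 32, 36, 40, 44, 49, 53, 57, 61]),
   (1229801703818430600, [3, 7, 11, 15, 18, 22, 26, 30, 33, 37, 41, 45, 48, 52, 56, 60])],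
  [(17293839061792849935, [0, 1, 2, 3, 20, 21, 22, 23, 40, 41, 42, 43, 60, 61, 62, 63]),
   (1081127793360568560, [4, 5, 6, 7, 16, 17, 18, 19, 44, 45, 46, 47, 56, 57, 58, 59]),
   (67554062861602560, [8, 9, 10, 11, 28, 29, 30, 31, 32, 33, 34, 35, 52, 53, 54, 55]),
   (4223155694530560, [12, 13, 14, 15, 24, 25, 26, 27, 36, 37, 38, 39, 48, 49, 50, 51])],
  [(1317339743034442785, [0, 5, 10, 15, 17, 20, 27, 30, 34, 39, 40, 45, 51, 54, 57, 60]),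
   (2415075402841147410, [1, 4, 11, 14, 16, 21, 26, 31, 35, 38, 41, 44, 50, 55, 56, 61]),
   (5193358597887107460, [2, 7, 8, 13, 19, 22, 25, 28, 32, 37, 42, 47, 49, 52, 59, 62]),
   (9520970329946853960, [3, 6, 9, 12, 18, 23, 24, 29, 33, 36, 43, 46, 48, 53, 58, 63])]]

theorem run_one : search clsOne clsOne.flatten [] 5 10 1 1 0 = true := by decide +kernel

theorem run_two_a :
    search clsTwo clsTwo.flatten [] 21 22 8 (mT 0 2 0 ||| mT 1 2 0) 0 = true := by
  decide +kernel

theorem run_two_b :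
    search clsTwo clsTwo.flatten [] 21 22 8 (mT 0 2 0 ||| mT 1 3 0) 0 = true := by
  decide +kernel

/-! ### The index model: points are the numbers `0, …, 63` -/

/-- Directions (tensor factors) of the blocks. -/
def dirs : List ℕ := [1, 4, 5, 16, 17, 20, 21]

/-- `A` hits all blocks for 2-density. -/
def Hit2 (A : Finset ℕ) : Prop := ∀ v ∈ dirs, ∀ i < 64, ∃ w < 4, i ^^^ (w * v) ∈ A

/-- Pullback of a point set. -/
def pull (g : ℕ → ℕ) (A : Finset ℕ) : Finset ℕ := (Finset.range 64).filter fun i => g i ∈ A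

theorem mem_pull {g : ℕ → ℕ} {A : Finset ℕ} {i : ℕ} : i ∈ pull g A ↔ i < 64 ∧ g i ∈ A := by
  simp [pull]

theorem dirs_lt : ∀ v ∈ dirs, ∀ w < 4, w * v < 64 := by decide +kernel

theorem xor_lt {i j : ℕ} (hi : i < 64) (hj : j < 64) : i ^^^ j < 64 :=
  Nat.xor_lt_two_pow (n := 6) hi hj

theorem pull_card {g : ℕ → ℕ} {A : Finset ℕ}
    (hinj : ∀ i < 64, ∀ j < 64, g i = g j → i = j) : (pull g A).card ≤ A.card := by
  apply Finset.card_le_card_of_injOn g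
  · intro i hi
    exact (mem_pull.1 hi).2
  · intro i hi j hj h
    exact hinj i (mem_pull.1 hi).1 j (mem_pull.1 hj).1 h

theorem pull_hit {g : ℕ → ℕ} {A : Finset ℕ} (hA : Hit2 A) (hlt : ∀ i < 64, g i < 64)
    (hg : ∀ v ∈ dirs, ∃ v' ∈ dirs, ∀ i < 64, ∀ w' < 4, ∃ w < 4,
      g (i ^^^ (w * v)) = g i ^^^ (w' * v')) : Hit2 (pull g A) := by
  intro v hv i hi
  obtain ⟨v', hv', h⟩ := hg v hv
  obtain ⟨w', hw', hm⟩ := hA v' hv' (g i) (hlt i hi)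
  obtain ⟨w, hw, e⟩ := h i hi w' hw'
  exact ⟨w, hw, mem_pull.2 ⟨xor_lt hi (dirs_lt v hv w hw), by rw [e]; exact hm⟩⟩

theorem xor_inj {t i j : ℕ} (h : i ^^^ t = j ^^^ t) : i = j := Nat.xor_left_injective h

theorem pull_xor_hit {t : ℕ} {A : Finset ℕ} (hA : Hit2 A) (ht : t < 64) :
    Hit2 (pull (fun i => i ^^^ t) A) := by
  refine pull_hit hA (fun i hi => xor_lt hi ht) ?_
  intro v hv
  refine ⟨v, hv, fun i _ w hw => ⟨w, hw, ?_⟩⟩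
  rw [Nat.xor_assoc, Nat.xor_assoc, Nat.xor_comm t]

/-- Permutations of the four field elements fixing zero, as base four numbers. -/
def perms : List ℕ := [228, 180, 216, 120, 156, 108]

/-- Simultaneous column operation on all rows. -/
def gP (l : ℕ) (i : ℕ) : ℕ :=
  Nat.add (Nat.add (Nat.mul 16 (Nat.mod (Nat.shiftRight l (Nat.mul 2 (Nat.div i 16))) 4))
    (Nat.mul 4 (Nat.mod (Nat.shiftRight l (Nat.mul 2 (Nat.mod (Nat.div i 4) 4))) 4)))
    (Nat.mod (Nat.shiftRight l (Nat.mul 2 (Nat.mod i 4))) 4)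

/-- Shear: adds the first row to the other rows. -/
def gS (a b i : ℕ) : ℕ := i ^^^ ((4 * a + b) * (i / 16))

theorem gP_lt : ∀ l ∈ perms, ∀ i < 64, gP l i < 64 := by decide +kernel

theorem gP_inv : ∀ l ∈ perms, ∃ l' ∈ perms, ∀ i < 64, gP l' (gP l i) = i := by decide +kernel

theorem gP_inj (l : ℕ) (hl : l ∈ perms) : ∀ i < 64, ∀ j < 64, gP l i = gP l j → i = j := by
  obtain ⟨l', _, h⟩ := gP_inv l hl
  intro i hi j hj e
  rw [← h i hi, e, h j hj]

theorem gP_hit : ∀ l ∈ perms, ∀ v ∈ dirs, ∃ v' ∈ dirs, ∀ i < 64, ∀ w' < 4, ∃ w < 4,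
    gP l (i ^^^ (w * v)) = gP l i ^^^ (w' * v') := by decide +kernel

theorem gS_lt : ∀ a < 2, ∀ b < 2, ∀ i < 64, gS a b i < 64 := by decide +kernel

theorem gS_inv : ∀ a < 2, ∀ b < 2, ∀ i < 64, gS a b (gS a b i) = i := by decide +kernel

theorem gS_inj (a : ℕ) (ha : a < 2) (b : ℕ) (hb : b < 2) :
    ∀ i < 64, ∀ j < 64, gS a b i = gS a b j → i = j := by
  intro i hi j hj e
  rw [← gS_inv a ha b hb i hi, e, gS_inv a ha b hb j hj]

theorem gS_hit : ∀ a < 2, ∀ b < 2, ∀ v ∈ dirs, ∃ v' ∈ dirs, ∀ i < 64, ∀ w' < 4, ∃ w < 4,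
    gS a b (i ^^^ (w * v)) = gS a b i ^^^ (w' * v') := by decide +kernel

theorem good_two : ∀ c ∈ clsTwo, GoodClass c := by decide +kernel

theorem good_one : ∀ c ∈ clsOne, GoodClass c := by decide +kernel

theorem blocks_two : ∀ b ∈ clsTwo.flatten, b.2.headD 0 < 64 ∧
    ∃ v ∈ dirs, ∀ w < 4, b.2.headD 0 ^^^ (w * v) ∈ b.2 := by
  decide +kernel

/-- The blocks of a slice. -/
def clsSlice (z : ℕ) : List (List Blk) :=
  match z with
  | 0 => clsSlice0
  | 1 => clsSlice1
  | 2 => clsSlice2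
  | _ => clsSlice3

theorem good_slice : ∀ z < 4, ∀ c ∈ clsSlice z, GoodClass c := by decide +kernel

theorem blocks_slice : ∀ z < 4, ∀ b ∈ (clsSlice z).flatten, (∀ p ∈ b.2, p / 16 = z) ∧
    b.2.headD 0 < 64 ∧
    ∃ v ∈ dirs, ∀ w < 4, b.2.headD 0 ^^^ (w * v) ∈ b.2 := by
  decide +kernel

theorem run_slice : ∀ z < 4,
    search (clsSlice z) (clsSlice z).flatten (goalsOf z) 5 10 0 0 0 = true ∧
    search (clsSlice z) (clsSlice z).flatten [] 3 10 0 0 0 = true := by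
  decide +kernel

theorem slice_hit {A : Finset ℕ} (hA : Hit2 A) {z : ℕ} (hz : z < 4) :
    ∀ b ∈ (clsSlice z).flatten, ∃ p ∈ b.2, p ∈ A.filter fun i => i / 16 = z := by
  intro b hb
  obtain ⟨h1, hi, v, hv, h⟩ := blocks_slice z hz b hb
  obtain ⟨w, hw, hm⟩ := hA v hv _ hi
  exact ⟨_, h w hw, Finset.mem_filter.2 ⟨hm, h1 _ (h w hw)⟩⟩

theorem slice_ge {A : Finset ℕ} (hA : Hit2 A) {z : ℕ} (hz : z < 4) :
    4 ≤ (A.filter fun i => i / 16 = z).card := by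
  by_contra hlt
  obtain ⟨g, hg, _⟩ := search_sound (clsSlice z) [] 3 (A.filter fun i => i / 16 = z) (by omega)
    (good_slice z hz) (slice_hit hA hz) 10 0 0 0 ∅ rfl (by simp) (by simp) (by simp)
    (run_slice z hz).2
  simp at hg

theorem goals_eq : ∀ z < 4, ∀ g ∈ goalsOf z, ∃ s ∈ [2, 3], ∃ c < 4, g = mT z s c := by
  decide +kernel

theorem slice_five {A : Finset ℕ} (hA : Hit2 A) {z : ℕ} (hz : z < 4)
    (h5 : (A.filter fun i => i / 16 = z).card ≤ 5) :
    ∃ s ∈ [2, 3], ∃ c < 4, ∀ p ∈ ptsT z s c, p ∈ A := by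
  obtain ⟨g, hg, h⟩ := search_sound (clsSlice z) (goalsOf z) 5 (A.filter fun i => i / 16 = z) h5
    (good_slice z hz) (slice_hit hA hz) 10 0 0 0 ∅ rfl (by simp) (by simp) (by simp)
    (run_slice z hz).1
  obtain ⟨s, hs, c, hc, rfl⟩ := goals_eq z hz g hg
  refine ⟨s, hs, c, hc, fun p hp => ?_⟩
  exact (Finset.mem_filter.1 (h p ((testBit_maskOf _ _).2 hp))).1

theorem two_slices {A : Finset ℕ} (hA : Hit2 A) (hsub : ∀ i ∈ A, i < 64) (h : A.card ≤ 21) :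
    ∃ z₀ < 4, ∃ z₁ < 4, z₀ ≠ z₁ ∧ (A.filter fun i => i / 16 = z₀).card ≤ 5 ∧
      (A.filter fun i => i / 16 = z₁).card ≤ 5 := by
  have hs := Finset.card_eq_sum_card_fiberwise (f := fun i => i / 16) (s := A)
    (t := Finset.range 4) (by
      intro i hi
      have := hsub i hi
      simp only [Finset.coe_range, Set.mem_Iio]
      omega)
  simp only [Finset.sum_range_succ, Finset.sum_range_zero] at hs
  have h0 := slice_ge hA (z := 0) (by norm_num)
  have h1 := slice_ge hA (z := 1) (by norm_num)
  have h2 := slice_ge hA (z := 2) (by norm_num)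
  have h3 := slice_ge hA (z := 3) (by norm_num)
  by_contra! hcon
  have a01 := hcon 0 (by norm_num) 1 (by norm_num) (by norm_num)
  have a02 := hcon 0 (by norm_num) 2 (by norm_num) (by norm_num)
  have a03 := hcon 0 (by norm_num) 3 (by norm_num) (by norm_num)
  have a12 := hcon 1 (by norm_num) 2 (by norm_num) (by norm_num)
  have a13 := hcon 1 (by norm_num) 3 (by norm_num) (by norm_num)
  have a23 := hcon 2 (by norm_num) 3 (by norm_num) (by norm_num)
  omega

theorem canon_false {A : Finset ℕ} (hA : Hit2 A) (h : A.card ≤ 21) {w : ℕ} (hw : w ∈ [2, 3])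
    (h0 : ∀ p ∈ ptsT 0 2 0, p ∈ A) (h1 : ∀ p ∈ ptsT 1 w 0, p ∈ A) : False := by
  have hrun : search clsTwo clsTwo.flatten [] 21 22 8 (mT 0 2 0 ||| mT 1 w 0) 0 = true := by
    simp only [List.mem_cons, List.not_mem_nil, or_false] at hw
    rcases hw with rfl | rfl
    · exact run_two_a
    · exact run_two_b
  have hcard : ((ptsT 0 2 0).toFinset ∪ (ptsT 1 w 0).toFinset).card = 8 := by
    simp only [List.mem_cons, List.not_mem_nil, or_false] at hw
    rcases hw with rfl | rfl <;> decide
  obtain ⟨g, hg, _⟩ := search_sound clsTwo [] 21 A h good_two (by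
      intro b hb
      obtain ⟨hi, v, hv, h⟩ := blocks_two b hb
      obtain ⟨w, hw, hm⟩ := hA v hv _ hi
      exact ⟨_, h w hw, hm⟩) 22 8 _ 0 ((ptsT 0 2 0).toFinset ∪ (ptsT 1 w 0).toFinset) hcard (by
      intro p hp
      rw [Finset.mem_union, List.mem_toFinset, List.mem_toFinset] at hp
      exact hp.elim (h0 p) (h1 p)) (by
      intro i
      rw [Nat.testBit_or, Bool.or_eq_true, mT, mT, testBit_maskOf, testBit_maskOf,
        Finset.mem_union, List.mem_toFinset, List.mem_toFinset]) (by simp) hrun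
  simp at hg

theorem canon_translate : ∀ z₀ < 4, ∀ z₁ < 4, ∀ s ∈ [2, 3], ∀ c₀ < 4, ∀ c₁ < 4,
    ∀ p ∈ ptsT (z₀ ^^^ z₁) s (c₀ ^^^ c₁), p < 64 ∧ (p ^^^ (16 * z₀ + c₀)) ∈ ptsT z₁ s c₁ := by
  decide +kernel

theorem xor_small : ∀ z₀ < 4, ∀ z₁ < 4, z₀ ^^^ z₁ < 4 ∧ (z₀ ≠ z₁ → z₀ ^^^ z₁ ∈ [1, 2, 3]) := by
  decide +kernel

theorem canon_linear : ∀ z ∈ [1, 2, 3], ∀ s₀ ∈ [2, 3], ∀ s₁ ∈ [2, 3], ∀ c < 4,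
    ∃ l ∈ perms, ∃ a < 2, ∃ b < 2, ∃ w ∈ [2, 3],
      (∀ p ∈ ptsT 0 2 0, p < 64 ∧ gS a b p < 64 ∧ gP l (gS a b p) ∈ ptsT 0 s₀ 0) ∧
      (∀ p ∈ ptsT 1 w 0, p < 64 ∧ gS a b p < 64 ∧ gP l (gS a b p) ∈ ptsT z s₁ c) := by
  decide +kernel

theorem two_lower {A : Finset ℕ} (hA : Hit2 A) (hsub : ∀ i ∈ A, i < 64) : 22 ≤ A.card := by
  by_contra hlt
  have h21 : A.card ≤ 21 := by omega
  obtain ⟨z₀, hz₀, z₁, hz₁, hne, h0, h1⟩ := two_slices hA hsub h21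
  obtain ⟨s₀, hs₀, c₀, hc₀, hT₀⟩ := slice_five hA hz₀ h0
  obtain ⟨s₁, hs₁, c₁, hc₁, hT₁⟩ := slice_five hA hz₁ h1
  have k0 := canon_translate z₀ hz₀ z₀ hz₀ s₀ hs₀ c₀ hc₀ c₀ hc₀
  rw [Nat.xor_self, Nat.xor_self] at k0
  have k1 := canon_translate z₀ hz₀ z₁ hz₁ s₁ hs₁ c₀ hc₀ c₁ hc₁
  have hz := (xor_small z₀ hz₀ z₁ hz₁).2 hne
  have hc := (xor_small c₀ hc₀ c₁ hc₁).1
  obtain ⟨l, hl, a, ha, b, hb, w, hw, m0, m1⟩ := canon_linear _ hz s₀ hs₀ s₁ hs₁ _ hc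
  have hit1 := pull_xor_hit (t := 16 * z₀ + c₀) hA (by omega)
  have hit2 := pull_hit hit1 (gP_lt l hl) (gP_hit l hl)
  have hit3 := pull_hit hit2 (gS_lt a ha b hb) (gS_hit a ha b hb)
  have d1 : (pull (fun i => i ^^^ (16 * z₀ + c₀)) A).card ≤ A.card :=
    pull_card fun i _ j _ h => xor_inj h
  have d2 := pull_card (A := pull (fun i => i ^^^ (16 * z₀ + c₀)) A) (gP_inj l hl)
  have d3 := pull_card (A := pull (gP l) (pull (fun i => i ^^^ (16 * z₀ + c₀)) A))
    (gS_inj a ha b hb)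
  refine canon_false hit3 (by omega) hw ?_ ?_
  · intro p hp
    obtain ⟨e1, e2, e3⟩ := m0 p hp
    obtain ⟨e4, e5⟩ := k0 _ e3
    exact mem_pull.2 ⟨e1, mem_pull.2 ⟨e2, mem_pull.2 ⟨e4, hT₀ _ e5⟩⟩⟩
  · intro p hp
    obtain ⟨e1, e2, e3⟩ := m1 p hp
    obtain ⟨e4, e5⟩ := k1 _ e3
    exact mem_pull.2 ⟨e1, mem_pull.2 ⟨e2, mem_pull.2 ⟨e4, hT₁ _ e5⟩⟩⟩

/-! ### Back to matrices -/

/-- The matrix encoded by an index. -/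
def dec (i : ℕ) : Matrix (Fin 3) (Fin 2) (ZMod 2) :=
  Matrix.of fun r c => if i.testBit (5 - 2 * r.val - c.val) then 1 else 0

theorem dec_xor (i j : ℕ) : dec (i ^^^ j) = dec i + dec j := by
  ext r c
  simp only [dec, Matrix.of_apply, Matrix.add_apply, Nat.testBit_xor]
  cases i.testBit (5 - 2 * r.val - c.val) <;> cases j.testBit (5 - 2 * r.val - c.val) <;> decide

/-- The index of a matrix. -/
def enc (X : Matrix (Fin 3) (Fin 2) (ZMod 2)) : ℕ :=
  32 * (X 0 0).val + 16 * (X 0 1).val + 8 * (X 1 0).val + 4 * (X 1 1).val + 2 * (X 2 0).val +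
    (X 2 1).val

theorem enc_dec : ∀ i < 64, enc (dec i) = i := by decide +kernel

theorem dec_inj : ∀ i < 64, ∀ j < 64, dec i = dec j → i = j := by
  intro i hi j hj h
  rw [← enc_dec i hi, h, enc_dec j hj]

theorem dec_surj (X : Matrix (Fin 3) (Fin 2) (ZMod 2)) : ∃ i < 64, dec i = X := by
  have hbij : Function.Bijective fun i : Fin 64 => dec i.val := by
    rw [Fintype.bijective_iff_injective_and_card]
    refine ⟨fun i j h => Fin.ext (dec_inj _ i.2 _ j.2 h), ?_⟩
    have : Fintype.card (Matrix (Fin 3) (Fin 2) (ZMod 2)) =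
      Fintype.card (Fin 3 → Fin 2 → ZMod 2) := rfl
    rw [this]
    simp [ZMod.card]
  obtain ⟨i, hi⟩ := hbij.2 X
  exact ⟨i.val, i.2, hi⟩

theorem rank_eq_iff {k : ℕ} (M : Matrix (Fin k) (Fin 3) (ZMod 2)) :
    M.rank = k ↔ ∀ u : Fin k → ZMod 2, u ᵥ* M = 0 → u = 0 := by
  have h1 : (∀ u : Fin k → ZMod 2, u ᵥ* M = 0 → u = 0) ↔ LinearIndependent (ZMod 2) M.row := by
    rw [← Matrix.vecMul_injective_iff]
    exact (injective_iff_map_eq_zero (Matrix.vecMulLinear M)).symm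
  rw [h1, linearIndependent_iff_card_eq_finrank_span, Matrix.rank_eq_finrank_span_row,
    Fintype.card_fin, Set.finrank]
  exact eq_comm

/-- A matrix of rank two with prescribed kernel. -/
def kerMat (v : ℕ) : Matrix (Fin 2) (Fin 3) (ZMod 2) :=
  if v = 1 then !![1, 0, 0; 0, 1, 0] else
  if v = 4 then !![1, 0, 0; 0, 0, 1] else
  if v = 5 then !![1, 0, 0; 0, 1, 1] else
  if v = 16 then !![0, 1, 0; 0, 0, 1] else
  if v = 17 then !![0, 1, 0; 1, 0, 1] else
  if v = 20 then !![1, 1, 0; 0, 0, 1] else !![1, 1, 0; 0, 1, 1]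

theorem kerMat_rank : ∀ v ∈ dirs, ∀ u : Fin 2 → ZMod 2, u ᵥ* kerMat v = 0 → u = 0 := by
  decide +kernel

theorem kerMat_ker : ∀ v ∈ dirs, ∀ j < 64, kerMat v * dec j = 0 → ∃ w < 4, j = w * v := by
  decide +kernel

theorem add_self_mat {a b : ℕ} (X : Matrix (Fin a) (Fin b) (ZMod 2)) : X + X = 0 := by
  ext i j
  exact CharTwo.add_self_eq_zero _

open Classical in
/-- The indices of the members of a set of matrices. -/
noncomputable def idx (S : Set (Matrix (Fin 3) (Fin 2) (ZMod 2))) (t : ℕ) : Finset ℕ :=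
  (Finset.range 64).filter fun i => dec (i ^^^ t) ∈ S

theorem mem_idx {S : Set (Matrix (Fin 3) (Fin 2) (ZMod 2))} {t i : ℕ} :
    i ∈ idx S t ↔ i < 64 ∧ dec (i ^^^ t) ∈ S := by
  classical
  simp [idx]

theorem idx_card (S : Set (Matrix (Fin 3) (Fin 2) (ZMod 2))) {t : ℕ} (ht : t < 64) :
    (idx S t).card ≤ S.ncard := by
  rw [← Set.ncard_coe_finset]
  refine Set.ncard_le_ncard_of_injOn (fun i => dec (i ^^^ t)) ?_ ?_ (Set.toFinite S)
  · intro i hi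
    exact (mem_idx.1 hi).2
  · intro i hi j hj h
    exact xor_inj (dec_inj _ (xor_lt (mem_idx.1 hi).1 ht) _ (xor_lt (mem_idx.1 hj).1 ht) h)

theorem lower_two (S : Set (Matrix (Fin 3) (Fin 2) (ZMod 2))) (hS : IsKDense 2 S) :
    22 ≤ S.ncard := by
  refine le_trans (two_lower ?_ fun i hi => (mem_idx.1 hi).1) (idx_card S (t := 0) (by norm_num))
  intro v hv i hi
  have himg := hS (kerMat v) ((rank_eq_iff _).2 (kerMat_rank v hv))
  have hmem : kerMat v * dec i ∈ (fun X => kerMat v * X) '' S := by rw [himg]; trivial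
  obtain ⟨X, hX, e⟩ := hmem
  obtain ⟨k, hk, rfl⟩ := dec_surj X
  obtain ⟨w, hw, hj⟩ := kerMat_ker v hv (i ^^^ k) (xor_lt hi hk) (by
    have e' : kerMat v * dec k = kerMat v * dec i := e
    rw [dec_xor, Matrix.mul_add, e', add_self_mat])
  refine ⟨w, hw, mem_idx.2 ?_⟩
  rw [← hj, Nat.xor_zero, ← Nat.xor_assoc, Nat.xor_self, Nat.zero_xor]
  exact ⟨hk, hX⟩

/-- Combination of the rows of an encoded matrix, in index form. -/
def dot (u i : ℕ) : ℕ :=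
  ((i % 4) * (u % 2)) ^^^ ((i / 4 % 4) * (u / 2 % 2)) ^^^ ((i / 16) * (u / 4))

/-- The row vector encoded by `u`. -/
def rowMat (u : ℕ) : Matrix (Fin 1) (Fin 3) (ZMod 2) :=
  Matrix.of fun _ r => if u.testBit (2 - r.val) then 1 else 0

/-- The row of length two encoded by `w`. -/
def rowVal (w : ℕ) : Matrix (Fin 1) (Fin 2) (ZMod 2) :=
  Matrix.of fun _ c => if w.testBit (1 - c.val) then 1 else 0

theorem rowMat_rank : ∀ u ∈ [1, 2, 3, 4, 5, 6, 7], ∀ x : Fin 1 → ZMod 2,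
    x ᵥ* rowMat u = 0 → x = 0 := by
  decide +kernel

theorem rowMat_dot : ∀ u ∈ [1, 2, 3, 4, 5, 6, 7], ∀ i < 64, ∀ w < 4,
    rowMat u * dec i = rowVal w → dot u i = w := by
  decide +kernel

theorem blocks_one : ∀ b ∈ clsOne.flatten, ∃ u ∈ [1, 2, 3, 4, 5, 6, 7], ∃ w < 4,
    ∀ i < 64, dot u i = w → i ∈ b.2 := by
  decide +kernel

theorem lower_one (S : Set (Matrix (Fin 3) (Fin 2) (ZMod 2))) (hS : IsKDense 1 S) :
    6 ≤ S.ncard := by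
  have hit : ∀ u ∈ [1, 2, 3, 4, 5, 6, 7], ∀ B, ∃ k < 64, dec k ∈ S ∧ rowMat u * dec k = B := by
    intro u hu B
    have himg := hS (rowMat u) ((rank_eq_iff _).2 (rowMat_rank u hu))
    have hmem : B ∈ (fun X => rowMat u * X) '' S := by rw [himg]; trivial
    obtain ⟨X, hX, e⟩ := hmem
    obtain ⟨k, hk, rfl⟩ := dec_surj X
    exact ⟨k, hk, hX, e⟩
  obtain ⟨t, ht, htS, _⟩ := hit 1 (by simp) 0
  by_contra hlt
  have hcard := idx_card S ht
  obtain ⟨g, hg, _⟩ := search_sound clsOne [] 5 (idx S t) (by omega) good_one (by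
      intro b hb
      obtain ⟨u, hu, w, hw, h⟩ := blocks_one b hb
      obtain ⟨k, hk, hkS, e⟩ := hit u hu (rowVal w + rowMat u * dec t)
      have hlt : k ^^^ t < 64 := xor_lt hk ht
      refine ⟨k ^^^ t, h _ hlt (rowMat_dot u hu _ hlt w hw ?_), mem_idx.2 ⟨hlt, ?_⟩⟩
      · rw [dec_xor, Matrix.mul_add, e, add_assoc, add_self_mat, add_zero]
      · rw [Nat.xor_assoc, Nat.xor_self, Nat.xor_zero]
        exact hkS) 10 1 1 0 {0} rfl (by
      rw [Finset.singleton_subset_iff, mem_idx, Nat.zero_xor]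
      exact ⟨by norm_num, htS⟩) (by
      intro i
      rw [Finset.mem_singleton, Nat.testBit_one_eq_true_iff_self_eq_zero]) (by simp) run_one
  simp at hg

/-- An optimal 1-dense set. -/
def sol6 : List ℕ := [2, 13, 17, 41, 48, 55]

/-- An optimal 2-dense set. -/
def sol22 : List ℕ := [3, 7, 8, 10, 11, 13, 19, 21, 24, 30, 33, 36, 40, 44, 46, 47, 48, 50, 51, 54,
  57, 62]

theorem sol6_dense : ∀ M : Matrix (Fin 1) (Fin 3) (ZMod 2),
    (∃ u : Fin 1 → ZMod 2, u ≠ 0 ∧ u ᵥ* M = 0) ∨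
      ∀ B : Matrix (Fin 1) (Fin 2) (ZMod 2), ∃ i ∈ sol6, M * dec i = B := by
  decide +kernel

theorem sol22_dense : ∀ M : Matrix (Fin 2) (Fin 3) (ZMod 2),
    (∃ u : Fin 2 → ZMod 2, u ≠ 0 ∧ u ᵥ* M = 0) ∨
      ∀ B : Matrix (Fin 2) (Fin 2) (ZMod 2), ∃ i ∈ sol22, M * dec i = B := by
  decide +kernel

theorem dense_of_list {k : ℕ} (l : List ℕ)
    (h : ∀ M : Matrix (Fin k) (Fin 3) (ZMod 2),
      (∃ u : Fin k → ZMod 2, u ≠ 0 ∧ u ᵥ* M = 0) ∨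
        ∀ B : Matrix (Fin k) (Fin 2) (ZMod 2), ∃ i ∈ l, M * dec i = B) :
    IsKDense k (dec '' (l.toFinset : Set ℕ)) := by
  intro M hM
  rw [rank_eq_iff] at hM
  rw [Set.eq_univ_iff_forall]
  intro B
  rcases h M with ⟨u, hu, hz⟩ | h
  · exact absurd (hM u hz) hu
  · obtain ⟨i, hi, e⟩ := h B
    exact ⟨dec i, ⟨i, by simpa using hi, rfl⟩, e⟩

theorem ncard_of_list (l : List ℕ) (h : ∀ i ∈ l, i < 64) :
    (dec '' (l.toFinset : Set ℕ)).ncard = l.toFinset.card := by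
  rw [Set.InjOn.ncard_image, Set.ncard_coe_finset]
  intro i hi j hj e
  exact dec_inj i (h i (by simpa using hi)) j (h j (by simpa using hj)) e

/-- Over `𝔽₂`: (i) the minimum size of a `1`-dense subset of `𝔽₂^{3×2}` is `6`;
(ii) the minimum size of a `2`-dense subset of `𝔽₂^{3×2}` is `22`. -/
theorem stmt19 :
    ((∀ 𝒜 : Set (Matrix (Fin 3) (Fin 2) (ZMod 2)), IsKDense 1 𝒜 → 6 ≤ 𝒜.ncard) ∧
      (∃ 𝒜 : Set (Matrix (Fin 3) (Fin 2) (ZMod 2)), IsKDense 1 𝒜 ∧ 𝒜.ncard = 6)) ∧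
    ((∀ 𝒜 : Set (Matrix (Fin 3) (Fin 2) (ZMod 2)), IsKDense 2 𝒜 → 22 ≤ 𝒜.ncard) ∧
      (∃ 𝒜 : Set (Matrix (Fin 3) (Fin 2) (ZMod 2)), IsKDense 2 𝒜 ∧ 𝒜.ncard = 22)) := by
  refine ⟨⟨lower_one, dec '' (sol6.toFinset : Set ℕ), dense_of_list sol6 sol6_dense, ?_⟩,
    lower_two, dec '' (sol22.toFinset : Set ℕ), dense_of_list sol22 sol22_dense, ?_⟩
  · rw [ncard_of_list sol6 (by decide)]
    decide
  · rw [ncard_of_list sol22 (by decide)]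
    decide
end
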